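/- Let g be a finite-dimensional real vector space endowed with an inner product ⟨·,·⟩, and let μ and λ be two Lie brackets on g such that λ lies in the closure of the orbit GL(g)·μ, where GL(g) acts on brackets by h·μ := hμ(h⁻¹·,h⁻¹·). If the Ricci operator Ric_λ of the metric Lie algebra (g, λ, ⟨·,·⟩) is negative definite, then there exists h ∈ GL(g) such that the Ricci operator Ric_{h·μ} of (g, h·μ, ⟨·,·⟩) is negative definite. -/

import Mathlib

open Finset
open scoped RealInnerProductSpace

noncomputable section

variable {V : Type*} [NormedAddCommGroup V] [InnerProductSpace ℝ V] [FiniteDimensional ℝ V]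

/-- The element `H` determined by `⟨H, X⟩ = tr (ad_μ X)`. -/
def ricH (μ : V →ₗ[ℝ] V →ₗ[ℝ] V) : V :=
  ∑ i, (LinearMap.trace ℝ V (μ (stdOrthonormalBasis ℝ V i))) • stdOrthonormalBasis ℝ V i

/-- The Ricci curvature form `⟨Ric_μ X, Y⟩` of the metric Lie algebra `(V, μ, ⟨·,·⟩)`,
computed in the orthonormal basis `stdOrthonormalBasis ℝ V`. -/
def ricciForm (μ : V →ₗ[ℝ] V →ₗ[ℝ] V) (X Y : V) : ℝ :=
  -(1/2) * ∑ i, ∑ j, ⟪μ X (stdOrthonormalBasis ℝ V i), stdOrthonormalBasis ℝ V j⟫ *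
      ⟪μ Y (stdOrthonormalBasis ℝ V i), stdOrthonormalBasis ℝ V j⟫
  + (1/4) * ∑ i, ∑ j, ⟪μ (stdOrthonormalBasis ℝ V i) (stdOrthonormalBasis ℝ V j), X⟫ *
      ⟪μ (stdOrthonormalBasis ℝ V i) (stdOrthonormalBasis ℝ V j), Y⟫
  - (1/2) * (LinearMap.trace ℝ V ((μ X) ∘ₗ (μ Y)))
  - (1/2) * (⟪μ (ricH μ) X, Y⟫ + ⟪μ (ricH μ) Y, X⟫)

/-- `μ` is a Lie bracket on `V`. -/
def IsLieBr (μ : V →ₗ[ℝ] V →ₗ[ℝ] V) : Prop :=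
  (∀ x, μ x x = 0) ∧ ∀ x y z, μ x (μ y z) + μ y (μ z x) + μ z (μ x y) = 0

/-- The action of `GL(V)` on brackets: `(h·μ)(x,y) = h μ(h⁻¹x, h⁻¹y)`. -/
def glAct (h : V ≃ₗ[ℝ] V) (μ : V →ₗ[ℝ] V →ₗ[ℝ] V) : V →ₗ[ℝ] V →ₗ[ℝ] V :=
  (μ.compl₁₂ h.symm.toLinearMap h.symm.toLinearMap).compr₂ h.toLinearMap

section Continuity

variable {ι : Type*} {l : Filter ι} {μ : ι → V →ₗ[ℝ] V →ₗ[ℝ] V} {lam : V →ₗ[ℝ] V →ₗ[ℝ] V}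

/-- Pointwise convergence of bilinear maps on a finite-dimensional space is continuous
convergence. -/
theorem tendsto_bilin (h : ∀ X Y, Filter.Tendsto (fun k => μ k X Y) l (nhds (lam X Y)))
    {x y : ι → V} {X Y : V} (hx : Filter.Tendsto x l (nhds X)) (hy : Filter.Tendsto y l (nhds Y)) :
    Filter.Tendsto (fun k => μ k (x k) (y k)) l (nhds (lam X Y)) := by
  have expand : ∀ (ν : V →ₗ[ℝ] V →ₗ[ℝ] V) (u v : V), ν u v =
      ∑ i, ∑ j, (⟪stdOrthonormalBasis ℝ V i, u⟫ * ⟪stdOrthonormalBasis ℝ V j, v⟫) •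
        ν (stdOrthonormalBasis ℝ V i) (stdOrthonormalBasis ℝ V j) := by
    intro ν u v
    conv_lhs =>
      rw [← (stdOrthonormalBasis ℝ V).sum_repr' u, ← (stdOrthonormalBasis ℝ V).sum_repr' v]
    simp only [map_sum, map_smul, LinearMap.sum_apply, LinearMap.smul_apply, smul_smul,
      Finset.smul_sum]
    rw [Finset.sum_comm]
    simp only [mul_comm]
  simp only [expand (μ _) (x _) (y _)]
  rw [expand lam X Y]
  exact tendsto_finsetSum _ fun i _ => tendsto_finsetSum _ fun j _ =>
    ((tendsto_const_nhds.inner hx).mul (tendsto_const_nhds.inner hy)).smul (h _ _)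

theorem tendsto_ricH (h : ∀ X Y, Filter.Tendsto (fun k => μ k X Y) l (nhds (lam X Y))) :
    Filter.Tendsto (fun k => ricH (μ k)) l (nhds (ricH lam)) := by
  simp only [ricH, LinearMap.trace_eq_sum_inner _ (stdOrthonormalBasis ℝ V)]
  exact tendsto_finsetSum _ fun i _ =>
    (tendsto_finsetSum _ fun j _ => tendsto_const_nhds.inner (h _ _)).smul_const _

theorem tendsto_ricciForm (h : ∀ X Y, Filter.Tendsto (fun k => μ k X Y) l (nhds (lam X Y)))
    {x y : ι → V} {X Y : V} (hx : Filter.Tendsto x l (nhds X)) (hy : Filter.Tendsto y l (nhds Y)) :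
    Filter.Tendsto (fun k => ricciForm (μ k) (x k) (y k)) l (nhds (ricciForm lam X Y)) := by
  simp only [ricciForm, LinearMap.trace_eq_sum_inner _ (stdOrthonormalBasis ℝ V),
    LinearMap.comp_apply]
  refine (((Filter.Tendsto.const_mul _ ?_).add (Filter.Tendsto.const_mul _ ?_)).sub
    (Filter.Tendsto.const_mul _ ?_)).sub (Filter.Tendsto.const_mul _ ?_)
  · exact tendsto_finsetSum _ fun i _ => tendsto_finsetSum _ fun j _ =>
      ((tendsto_bilin h hx tendsto_const_nhds).inner tendsto_const_nhds).mul
        ((tendsto_bilin h hy tendsto_const_nhds).inner tendsto_const_nhds)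
  · exact tendsto_finsetSum _ fun i _ => tendsto_finsetSum _ fun j _ =>
      ((h _ _).inner hx).mul ((h _ _).inner hy)
  · exact tendsto_finsetSum _ fun i _ =>
      tendsto_const_nhds.inner (tendsto_bilin h hx (tendsto_bilin h hy tendsto_const_nhds))
  · exact ((tendsto_bilin h (tendsto_ricH h) hx).inner hy).add
      ((tendsto_bilin h (tendsto_ricH h) hy).inner hx)

end Continuity

theorem ricciForm_smul_smul (μ : V →ₗ[ℝ] V →ₗ[ℝ] V) (c : ℝ) (X Y : V) :
    ricciForm μ (c • X) (c • Y) = c ^ 2 * ricciForm μ X Y := by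
  have comm : ∀ a b : ℝ, (c * a) * (c * b) = c ^ 2 * (a * b) := fun a b => by ring
  simp only [ricciForm, map_smul, LinearMap.smul_apply, real_inner_smul_left,
    real_inner_smul_right, comm, ← Finset.mul_sum, LinearMap.smul_comp, LinearMap.comp_smul,
    smul_eq_mul]
  ring

/-- **Degeneration Principle for Ricci negative metrics.**
If `λ` lies in the closure of the orbit `GL(g)·μ` and the Ricci operator of `(g, λ, ⟨·,·⟩)` is
negative definite, then some `h·μ` also has negative definite Ricci operator, i.e. `G_μ` admits
a left-invariant metric of negative Ricci curvature. -/
theorem degeneration_principle (μ lam : V →ₗ[ℝ] V →ₗ[ℝ] V)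
    (hμ : IsLieBr μ) (hlam : IsLieBr lam)
    (hdeg : ∃ h : ℕ → (V ≃ₗ[ℝ] V), ∀ X Y : V,
      Filter.Tendsto (fun k => glAct (h k) μ X Y) Filter.atTop (nhds (lam X Y)))
    (hneg : ∀ X : V, X ≠ 0 → ricciForm lam X X < 0) :
    ∃ h : V ≃ₗ[ℝ] V, ∀ X : V, X ≠ 0 → ricciForm (glAct h μ) X X < 0 := by
  obtain ⟨h, hh⟩ := hdeg
  by_contra! hcon
  choose x hx0 hx using fun k => hcon (h k)
  have hmem : ∀ k, ‖x k‖⁻¹ • x k ∈ Metric.sphere (0 : V) 1 := fun k => by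
    simp [norm_smul, hx0 k]
  obtain ⟨X, hX, φ, hφ, hlim⟩ := (isCompact_sphere (0 : V) 1).tendsto_subseq hmem
  have hlim' := tendsto_ricciForm (fun Y Z => (hh Y Z).comp hφ.tendsto_atTop) hlim hlim
  refine (hneg X (ne_zero_of_mem_unit_sphere ⟨X, hX⟩)).not_ge
    (ge_of_tendsto' hlim' fun k => ?_)
  simp only [Function.comp_apply, ricciForm_smul_smul]
  exact mul_nonneg (sq_nonneg _) (hx _)

end
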